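/- For j = 1, 2, let 𝒯_j = (V_j, ℰ_j) be a leafless, locally finite rooted directed tree and let S^{(j)}_{λ,1} be the Dirichlet shift on ℓ²(V_j) with parameter q = 1. Then there exists a unitary operator U : ℓ²(V_1) → ℓ²(V_2) with U S^{(1)}_{λ,1} = S^{(2)}_{λ,1} U if and only if Σ_{v∈V^{(1)}_≺} (card Chi(v) − 1) = Σ_{v∈V^{(2)}_≺} (card Chi(v) − 1), where both sums are taken in ℕ ∪ {∞} and V^{(j)}_≺ denotes the set of branching vertices of 𝒯_j. -/

import Mathlib

open scoped ENNReal InnerProductSpace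
open ContinuousLinearMap

noncomputable section

/-- A (countably infinite) rooted directed tree. -/
structure DirTree (V : Type) where
  edge : V → V → Prop
  not_self : ∀ v, ¬ edge v v
  no_circuit : ∀ v, ¬ Relation.TransGen edge v v
  connected : ∀ u v : V, Relation.ReflTransGen (fun a b => edge a b ∨ edge b a) u v
  uniq_parent : ∀ {u w v : V}, edge u v → edge w v → u = w
  root : V
  root_no_parent : ∀ u, ¬ edge u root
  root_uniq : ∀ v, (∀ u, ¬ edge u v) → v = root

namespace DirTree

variable {V : Type} (T : DirTree V)

/-- The set of children of a vertex. -/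
def chi (v : V) : Set V := {u | T.edge v u}

/-- Leafless: every vertex has a child. -/
def Leafless : Prop := ∀ v : V, ∃ u, T.edge v u

/-- Locally finite: every vertex has finitely many children. -/
def LocFin : Prop := ∀ v : V, (T.chi v).Finite

/-- The finset of children of a vertex (locally finite case). -/
def chiFin (hT : T.LocFin) (v : V) : Finset V := (hT v).toFinset

/-- Iterated child sets `Chi^⟨n⟩(W)`. -/
def chiIter (T : DirTree V) : ℕ → Set V → Set V
  | 0, W => W
  | n + 1, W => {u | ∃ v ∈ chiIter T n W, T.edge v u}

/-- The depth of a vertex: the unique `n` with `v ∈ Chi^⟨n⟩(root)`. -/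
def depth (v : V) : ℕ := sInf {n | v ∈ T.chiIter n {T.root}}

/-- The parent map (junk value at the root). -/
def par (v : V) : V :=
  letI := Classical.propDecidable (∃ u, T.edge u v)
  if h : ∃ u, T.edge u v then h.choose else v

end DirTree

/-- `ℓ²(V)`. -/
abbrev l2 (V : Type) := lp (fun _ : V => ℂ) 2

/-- The standard orthonormal basis vector `e_v` of `ℓ²(V)`. -/
def evec {V : Type} (v : V) : l2 V :=
  letI := Classical.decEq V
  lp.single 2 v 1

/-- The Pochhammer symbol `(x)_k = x (x+1) ⋯ (x+k-1)`. -/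
def poch (x : ℝ) (k : ℕ) : ℝ := ∏ i ∈ Finset.range k, (x + i)

namespace DirTree

variable {V : Type} (T : DirTree V)

/-- The weight `λ_{u,q}` (for any child `u` of `v`). -/
def wt (hT : T.LocFin) (q : ℝ) (v : V) : ℝ :=
  Real.sqrt (((T.depth v : ℝ) + q) / ((T.depth v : ℝ) + 1)) /
    Real.sqrt ((T.chiFin hT v).card)

/-- `S` is the Dirichlet shift with parameter `q` on `ℓ²(V)`:
`S e_v = ∑_{u ∈ Chi(v)} λ_{u,q} e_u`. -/
def IsDirichletShift (hT : T.LocFin) (q : ℝ) (S : l2 V →L[ℂ] l2 V) : Prop :=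
  ∀ v : V, S (evec v) = ∑ u ∈ T.chiFin hT v, ((T.wt hT q v : ℝ) : ℂ) • evec u

end DirTree

/-- The Cauchy dual `S (S*S)⁻¹` of a left-invertible operator. -/
def cauchyDual {V : Type} (S : l2 V →L[ℂ] l2 V) : l2 V →L[ℂ] l2 V :=
  S * Ring.inverse (ContinuousLinearMap.adjoint S * S)

section Wold

variable {H : Type*} [NormedAddCommGroup H] [InnerProductSpace ℂ H] {S : H →L[ℂ] H}

theorem HilbertBasis.clm_ext {κ E F : Type*} [NormedAddCommGroup E] [InnerProductSpace ℂ E]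
    [NormedAddCommGroup F] [NormedSpace ℂ F] (b : HilbertBasis κ ℂ E) {f g : E →L[ℂ] F}
    (h : ∀ i, f (b i) = g (b i)) : f = g :=
  ContinuousLinearMap.ext_on (Submodule.dense_iff_topologicalClosure_eq_top.2 b.dense_span)
    (by rintro _ ⟨i, rfl⟩; exact h i)

theorem exists_intertwining_of_shift_bases {H' κ κ' : Type*} [NormedAddCommGroup H']
    [InnerProductSpace ℂ H'] [CompleteSpace H'] {S' : H' →L[ℂ] H'} (e : κ ≃ κ')
    (B : HilbertBasis (ℕ × κ) ℂ H) (hB : ∀ n i, S (B (n, i)) = B (n + 1, i))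
    (B' : HilbertBasis (ℕ × κ') ℂ H') (hB' : ∀ n i, S' (B' (n, i)) = B' (n + 1, i)) :
    ∃ U : H ≃ₗᵢ[ℂ] H', ∀ f, U (S f) = S' (U f) := by
  classical
  let g : ℕ × κ → H' := B' ∘ Equiv.prodCongr (Equiv.refl ℕ) e
  have hg : Orthonormal ℂ g :=
    B'.orthonormal.comp _ (Equiv.prodCongr (Equiv.refl ℕ) e).injective
  have hr : Set.range g = Set.range B' :=
    (Equiv.prodCongr (Equiv.refl ℕ) e).surjective.range_comp B'
  let C : HilbertBasis (ℕ × κ) ℂ H' := HilbertBasis.mk hg (by rw [hr, B'.dense_span])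
  have hC : ∀ p, C p = B' (p.1, e p.2) := fun p => by simp [C, g, Prod.map]
  let U := B.repr.trans C.repr.symm
  have hU : ∀ p, U (B p) = C p := fun p => by
    simp [U, B.repr_self]
  refine ⟨U, fun f => ?_⟩
  have : (U.toContinuousLinearEquiv : H →L[ℂ] H').comp S =
      S'.comp (U.toContinuousLinearEquiv : H →L[ℂ] H') := by
    refine B.clm_ext ?_
    rintro ⟨n, i⟩
    simp [hB, hU, hC, hB']
  exact DFunLike.congr_fun this f

variable [CompleteSpace H]

theorem inner_pow_apply_pow_apply (hS : ∀ x, adjoint S (S x) = x) (n : ℕ) (x y : H) :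
    ⟪(S ^ n) x, (S ^ n) y⟫_ℂ = ⟪x, y⟫_ℂ := by
  induction n with
  | zero => simp
  | succ n ih => rw [pow_succ', mul_def, comp_apply, comp_apply, ← adjoint_inner_right, hS, ih]

theorem inner_pow_apply_of_mem_ker_adjoint (hS : ∀ x, adjoint S (S x) = x) {m n : ℕ}
    (hmn : m < n) {x : H} (hx : adjoint S x = 0) (y : H) :
    ⟪(S ^ m) x, (S ^ n) y⟫_ℂ = 0 := by
  obtain ⟨k, rfl⟩ := Nat.exists_eq_add_of_lt hmn
  rw [add_assoc, pow_add, mul_def, comp_apply, inner_pow_apply_pow_apply hS, pow_succ',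
    mul_def, comp_apply, ← adjoint_inner_left, hx, inner_zero_left]

theorem apply_adjoint_apply_eq_self (hS : ∀ x, adjoint S (S x) = x) {y : H}
    (hy : ∀ z, adjoint S z = 0 → ⟪z, y⟫_ℂ = 0) : S (adjoint S y) = y := by
  have hz : adjoint S (y - S (adjoint S y)) = 0 := by rw [map_sub, hS, sub_self]
  refine (sub_eq_zero.1 (inner_self_eq_zero (𝕜 := ℂ).1 ?_)).symm
  rw [inner_sub_right, hy _ hz, ← adjoint_inner_left, hz, inner_zero_left, sub_zero]

/-- A pure isometry is a unilateral shift: a Hilbert basis of its wandering subspace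
`ker S†` propagates to a Hilbert basis of the whole space. -/
theorem exists_hilbertBasis_shift (hS : ∀ x, adjoint S (S x) = x)
    (hpure : ∀ x, (∀ n : ℕ, ∃ y, (S ^ n) y = x) → x = 0)
    {κ : Type*} (b : HilbertBasis κ ℂ (adjoint S).ker) :
    ∃ B : HilbertBasis (ℕ × κ) ℂ H, ∀ n i, S (B (n, i)) = B (n + 1, i) := by
  classical
  let F : ℕ × κ → H := fun p => (S ^ p.1) (b p.2 : H)
  have hker : ∀ i, adjoint S (b i : H) = 0 := fun i => (b i).2
  have horth : Orthonormal ℂ F := by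
    rw [orthonormal_iff_ite]
    rintro ⟨m, i⟩ ⟨n, j⟩
    rcases lt_trichotomy m n with h | rfl | h
    · rw [if_neg (by simp [h.ne])]
      exact inner_pow_apply_of_mem_ker_adjoint hS h (hker i) _
    · have := orthonormal_iff_ite.1 b.orthonormal i j
      simp only [F, inner_pow_apply_pow_apply hS, Prod.mk.injEq, true_and]
      exact this
    · rw [if_neg (by simp [h.ne']), ← inner_conj_symm,
        inner_pow_apply_of_mem_ker_adjoint hS h (hker j) _, map_zero]
  have hbot : (Submodule.span ℂ (Set.range F))ᗮ = ⊥ := by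
    rw [eq_bot_iff]
    intro x hx
    have hxF : ∀ n i, ⟪(S ^ n) (b i : H), x⟫_ℂ = 0 := fun n i =>
      (Submodule.mem_orthogonal _ _).1 hx _ (Submodule.subset_span ⟨(n, i), rfl⟩)
    refine hpure x fun n => ?_
    induction n with
    | zero => exact ⟨x, by simp⟩
    | succ n ih =>
      obtain ⟨y, rfl⟩ := ih
      refine ⟨adjoint S y, ?_⟩
      rw [pow_succ, mul_def, comp_apply, apply_adjoint_apply_eq_self hS]
      intro z hz
      have hcl : ∀ w : (adjoint S).ker, ⟪y, (w : H)⟫_ℂ = 0 := by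
        have : (innerSL ℂ y).comp (adjoint S).ker.subtypeL = 0 := by
          refine b.clm_ext fun i => ?_
          have := hxF n i
          rw [inner_pow_apply_pow_apply hS] at this
          simpa using inner_eq_zero_symm.1 this
        exact fun w => DFunLike.congr_fun this w
      exact inner_eq_zero_symm.1 (hcl ⟨z, hz⟩)
  refine ⟨HilbertBasis.mkOfOrthogonalEqBot horth hbot, fun n i => ?_⟩
  simp only [HilbertBasis.coe_mkOfOrthogonalEqBot, F, pow_succ', mul_def, comp_apply]

theorem HilbertBasis.toENat_rank {κ E : Type} [NormedAddCommGroup E] [InnerProductSpace ℂ E]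
    (b : HilbertBasis κ ℂ E) : (Module.rank ℂ E).toENat = ENat.card κ := by
  rcases finite_or_infinite κ with hκ | hκ
  · have := Fintype.ofFinite κ
    rw [rank_eq_card_basis b.toOrthonormalBasis.toBasis]
    simp
  · have := b.orthonormal.linearIndependent.cardinal_le_rank
    simp [Cardinal.toENat_eq_top.2 ((Cardinal.aleph0_le_mk κ).trans this)]

theorem Orthonormal.countable_of_hilbertBasis {ι κ E : Type*} [Countable ι]
    [NormedAddCommGroup E] [InnerProductSpace ℂ E] (b : HilbertBasis ι ℂ E) {v : κ → E}
    (hv : Orthonormal ℂ v) : Countable κ := by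
  have hcount : ∀ i, (Function.support fun k => ‖⟪v k, b i⟫_ℂ‖ ^ 2).Countable := fun i =>
    (hv.inner_products_summable (b i)).countable_support
  rw [← Set.countable_univ_iff]
  refine (Set.countable_iUnion hcount).mono fun k _ => ?_
  by_contra hk
  have : innerSL ℂ (v k) = 0 := b.clm_ext fun i => by
    simp only [Set.mem_iUnion, not_exists, Function.mem_support, not_not] at hk
    simpa using hk i
  have h0 := DFunLike.congr_fun this (v k)
  simp [hv.1 k] at h0

theorem rank_ker_adjoint_le_of_intertwining {H K : Type} [NormedAddCommGroup H]
    [InnerProductSpace ℂ H] [CompleteSpace H] [NormedAddCommGroup K] [InnerProductSpace ℂ K]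
    [CompleteSpace K] {S : H →L[ℂ] H} {S' : K →L[ℂ] K} (U : H ≃ₗᵢ[ℂ] K)
    (hU : ∀ f, U (S f) = S' (U f)) :
    Module.rank ℂ (adjoint S).ker ≤ Module.rank ℂ (adjoint S').ker := by
  have hmap : ∀ x ∈ (adjoint S).ker, U.toLinearEquiv.toLinearMap x ∈ (adjoint S').ker := by
    intro x hx
    have hx' : adjoint S x = 0 := hx
    change adjoint S' (U x) = 0
    refine ext_inner_right ℂ fun y => ?_
    obtain ⟨z, rfl⟩ := U.surjective y
    rw [adjoint_inner_left, ← hU, U.inner_map_map, ← adjoint_inner_left, hx', inner_zero_left,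
      inner_zero_left]
  refine LinearMap.rank_le_of_injective (U.toLinearEquiv.toLinearMap.restrict hmap) ?_
  intro x y hxy
  exact Subtype.ext (U.injective (congrArg Subtype.val hxy))

theorem exists_equiv_of_enatCard_eq {α β : Type} [Countable α] [Countable β]
    (h : ENat.card α = ENat.card β) : Nonempty (α ≃ β) :=
  Cardinal.eq.1 ((Cardinal.toENat_eq_iff_of_le_aleph0 Cardinal.mk_le_aleph0
    Cardinal.mk_le_aleph0).1 h)

end Wold

section TreeShift

theorem evec_apply {V : Type} [DecidableEq V] (v u : V) :
    (evec v : V → ℂ) u = if u = v then 1 else 0 := by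
  simp only [evec, lp.single_apply]
  split_ifs with h
  · subst h; simp
  · simp [h]

theorem inner_evec_left {V : Type} (v : V) (f : l2 V) : ⟪evec v, f⟫_ℂ = f v := by
  simp [evec, lp.inner_single_left]

/-- The standard Hilbert basis of `ℓ²(V)`. -/
def evecBasis (V : Type) : HilbertBasis V ℂ (l2 V) :=
  HilbertBasis.ofRepr (LinearIsometryEquiv.refl ℂ (l2 V))

theorem evecBasis_apply {V : Type} (v : V) : evecBasis V v = evec v := by
  classical
  rw [← HilbertBasis.repr_symm_single]
  change lp.single (E := fun _ : V => ℂ) 2 v 1 = _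
  rw [evec]

namespace DirTree

variable {V : Type} {T : DirTree V} {hT : T.LocFin} {S : l2 V →L[ℂ] l2 V}

theorem mem_chiFin {u v : V} : u ∈ T.chiFin hT v ↔ T.edge v u := by
  simp [chiFin, chi]

theorem reflTransGen_root (T : DirTree V) (v : V) : Relation.ReflTransGen T.edge T.root v := by
  induction T.connected T.root v with
  | refl => exact .refl
  | tail _ h ih =>
    rcases h with h | h
    · exact ih.tail h
    · rcases Relation.ReflTransGen.cases_tail ih with rfl | ⟨c, hc, hca⟩
      · exact absurd h (T.root_no_parent _)
      · rwa [T.uniq_parent h hca]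

theorem card_chiFin_pos (hL : T.Leafless) (v : V) : 0 < (T.chiFin hT v).card :=
  Finset.card_pos.2 ((hL v).imp fun _ hu => mem_chiFin.2 hu)

theorem wt_one (v : V) : T.wt hT 1 v = 1 / Real.sqrt (T.chiFin hT v).card := by
  rw [wt, div_self (by positivity), Real.sqrt_one]

theorem wt_one_pos (hL : T.Leafless) (v : V) : 0 < T.wt hT 1 v := by
  have : (0 : ℝ) < (T.chiFin hT v).card := by exact_mod_cast card_chiFin_pos hL v
  rw [wt_one]
  positivity

theorem card_mul_wt_one_sq (hL : T.Leafless) (v : V) :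
    ((T.chiFin hT v).card : ℝ) * (T.wt hT 1 v * T.wt hT 1 v) = 1 := by
  have : (0 : ℝ) < (T.chiFin hT v).card := by exact_mod_cast card_chiFin_pos hL v
  rw [wt_one, div_mul_div_comm, Real.mul_self_sqrt this.le]
  field_simp

namespace IsDirichletShift

variable {q : ℝ}

theorem adjoint_apply (hS : T.IsDirichletShift hT q S) (f : l2 V) (v : V) :
    adjoint S f v = T.wt hT q v * ∑ u ∈ T.chiFin hT v, f u := by
  rw [← inner_evec_left, adjoint_inner_right, hS v, sum_inner, Finset.mul_sum]
  refine Finset.sum_congr rfl fun u _ => ?_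
  rw [inner_smul_left, inner_evec_left, Complex.conj_ofReal]

theorem apply_child (hS : T.IsDirichletShift hT q S) {u v : V} (h : T.edge v u) (f : l2 V) :
    S f u = T.wt hT q v * f v := by
  classical
  have : (innerSL ℂ (evec u)).comp S = (T.wt hT q v : ℂ) • innerSL ℂ (evec v) := by
    refine (evecBasis V).clm_ext fun w => ?_
    simp only [comp_apply, innerSL_apply_apply, evecBasis_apply, hS w, inner_sum, smul_apply,
      inner_smul_right, inner_evec_left, evec_apply, smul_eq_mul]
    by_cases hw : v = w
    · subst hw
      simp [mem_chiFin, h]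
    · have : ¬ T.edge w u := fun h' => hw (T.uniq_parent h h')
      simp [mem_chiFin, this, hw]
  simpa [inner_evec_left] using DFunLike.congr_fun this f

theorem apply_root (hS : T.IsDirichletShift hT q S) (f : l2 V) : S f T.root = 0 := by
  classical
  have : (innerSL ℂ (evec T.root)).comp S = 0 := by
    refine (evecBasis V).clm_ext fun w => ?_
    have := T.root_no_parent w
    simp [evecBasis_apply, hS w, inner_evec_left, evec_apply, mem_chiFin, this]
  simpa [inner_evec_left] using DFunLike.congr_fun this f

theorem adjoint_apply_apply (hL : T.Leafless) (hS : T.IsDirichletShift hT 1 S) (f : l2 V) :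
    adjoint S (S f) = f := by
  ext v
  have : ∀ u ∈ T.chiFin hT v, S f u = T.wt hT 1 v * f v := fun u hu =>
    hS.apply_child (mem_chiFin.1 hu) f
  rw [hS.adjoint_apply, Finset.sum_congr rfl this, Finset.sum_const, nsmul_eq_mul]
  have h1 : (((T.chiFin hT v).card : ℝ) * (T.wt hT 1 v * T.wt hT 1 v) : ℂ) = 1 := by
    exact_mod_cast card_mul_wt_one_sq (hT := hT) hL v
  push_cast at h1
  linear_combination f v * h1

theorem eq_zero_of_forall_mem_range_pow (hS : T.IsDirichletShift hT q S) (f : l2 V)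
    (hf : ∀ n : ℕ, ∃ g, (S ^ n) g = f) : f = 0 := by
  ext v
  suffices ∃ n : ℕ, ∀ g, (S ^ n) g v = 0 by
    obtain ⟨n, hn⟩ := this
    obtain ⟨g, rfl⟩ := hf n
    exact hn g
  induction T.reflTransGen_root v with
  | refl => exact ⟨1, fun g => by rw [pow_one, hS.apply_root]⟩
  | tail _ h ih =>
    obtain ⟨n, hn⟩ := ih
    refine ⟨n + 1, fun g => ?_⟩
    rw [pow_succ', mul_def, comp_apply, hS.apply_child h, hn, mul_zero]

theorem mem_ker_adjoint_iff (hL : T.Leafless) (hS : T.IsDirichletShift hT 1 S) {f : l2 V} :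
    f ∈ (adjoint S).ker ↔ ∀ v, ∑ u ∈ T.chiFin hT v, f u = 0 := by
  have hw : ∀ v, (T.wt hT 1 v : ℂ) ≠ 0 := fun v => by exact_mod_cast (wt_one_pos hL v).ne'
  constructor
  · intro hf v
    have h0 : adjoint S f = 0 := hf
    have := hS.adjoint_apply f v
    rw [h0] at this
    simpa [hw v] using this.symm
  · intro h
    change adjoint S f = 0
    ext v
    rw [hS.adjoint_apply, h v, mul_zero]
    rfl

/-- The vertices other than one chosen child `c v` for each `v` parametrize `ker S†`. -/
theorem toENat_rank_ker_adjoint (hL : T.Leafless) (hS : T.IsDirichletShift hT 1 S) {c : V → V}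
    (hc : ∀ v, T.edge v (c v)) :
    (Module.rank ℂ (adjoint S).ker).toENat = ENat.card {u : V // u ∉ Set.range c} := by
  classical
  let R : (adjoint S).ker →ₗ[ℂ] ({u : V // u ∉ Set.range c} → ℂ) :=
    { toFun := fun f i => (f : l2 V) i
      map_add' := fun f g => rfl
      map_smul' := fun a f => rfl }
  have hRapply : ∀ f i, R f i = (f : l2 V) i := fun _ _ => rfl
  have hnotMem : ∀ {v u}, T.edge v u → u ≠ c v → u ∉ Set.range c := by
    rintro v u huv hne ⟨w, rfl⟩
    exact hne (congrArg c (T.uniq_parent (hc w) huv))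
  have hR : Function.Injective R := by
    rw [← LinearMap.ker_eq_bot, LinearMap.ker_eq_bot']
    intro f hf
    have hf0 : ∀ u, u ∉ Set.range c → (f : l2 V) u = 0 := fun u hu => congrFun hf ⟨u, hu⟩
    refine Subtype.ext (lp.ext (funext fun u => ?_))
    by_cases hu : u ∈ Set.range c
    · obtain ⟨v, rfl⟩ := hu
      have hsum := (hS.mem_ker_adjoint_iff hL).1 f.2 v
      rwa [Finset.sum_eq_single_of_mem (c v) (mem_chiFin.2 (hc v))
        fun u hu hne => hf0 u (hnotMem (mem_chiFin.1 hu) hne)] at hsum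
    · exact hf0 u hu
  have hex : ∀ i, ∃ w, R w = Pi.single i 1 := by
    rintro ⟨i, hi⟩
    by_cases hp : ∃ p, T.edge p i
    · obtain ⟨p, hp⟩ := hp
      refine ⟨⟨evec i - evec (c p), (hS.mem_ker_adjoint_iff hL).2 fun v => ?_⟩, ?_⟩
      · have h1 : T.edge v i ↔ v = p := ⟨fun h => T.uniq_parent h hp, by rintro rfl; exact hp⟩
        have h2 : T.edge v (c p) ↔ v = p :=
          ⟨fun h => T.uniq_parent h (hc p), by rintro rfl; exact hc v⟩
        simp [evec_apply, mem_chiFin, h1, h2]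
      · funext ⟨j, hj⟩
        have : j ≠ c p := fun h => hj ⟨p, h.symm⟩
        rw [hRapply]
        simp [evec_apply, Pi.single_apply, this]
    · refine ⟨⟨evec i, (hS.mem_ker_adjoint_iff hL).2 fun v => ?_⟩, ?_⟩
      · have : ¬ T.edge v i := fun h => hp ⟨v, h⟩
        simp [evec_apply, mem_chiFin, this]
      · funext ⟨j, hj⟩
        rw [hRapply]
        simp [evec_apply, Pi.single_apply]
  choose w hw using hex
  have hli : LinearIndependent ℂ w := by
    refine LinearIndependent.of_comp R ?_
    convert Pi.linearIndependent_single_one {u : V // u ∉ Set.range c} ℂ using 1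
    exact funext hw
  refine le_antisymm ?_ (Cardinal.toENat.monotone' hli.cardinal_le_rank)
  rcases finite_or_infinite {u : V // u ∉ Set.range c} with hfin | hinf
  · have := Fintype.ofFinite {u : V // u ∉ Set.range c}
    have hle := LinearMap.rank_le_of_injective R hR
    rw [rank_fun'] at hle
    rw [ENat.card_eq_coe_fintype_card]
    exact Cardinal.toENat_le_natCast.2 hle
  · rw [ENat.card_eq_top_of_infinite]
    exact le_top

end IsDirichletShift

theorem enatCard_notMem_range (T : DirTree V) (hT : T.LocFin) {c : V → V}
    (hc : ∀ v, T.edge v (c v)) :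
    (ENat.card {u : V // u ∉ Set.range c} : ℝ≥0∞) =
      1 + ∑' v : {v : V // 2 ≤ (T.chiFin hT v).card},
        (((T.chiFin hT v.1).card - 1 : ℕ) : ℝ≥0∞) := by
  classical
  let g : Unit ⊕ (Σ v, {u // u ∈ (T.chiFin hT v).erase (c v)}) → {u : V // u ∉ Set.range c} :=
    Sum.elim
      (fun _ => ⟨T.root, by rintro ⟨v, hv⟩; exact T.root_no_parent v (hv ▸ hc v)⟩)
      (fun p => ⟨p.2.1, by
        rintro ⟨w, hw⟩
        obtain ⟨hne, hmem⟩ := Finset.mem_erase.1 p.2.2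
        exact hne (hw ▸ congrArg c (T.uniq_parent (hw ▸ hc w) (mem_chiFin.1 hmem)))⟩)
  have hg : Function.Bijective g := by
    constructor
    · have hedge : ∀ p : (Σ v, {u // u ∈ (T.chiFin hT v).erase (c v)}), T.edge p.1 p.2.1 :=
        fun p => mem_chiFin.1 (Finset.mem_of_mem_erase p.2.2)
      rintro (_ | p) (_ | p') h
      · rfl
      · have h' : T.root = p'.2.1 := congrArg Subtype.val h
        exact absurd (h' ▸ hedge p') (T.root_no_parent _)
      · have h' : p.2.1 = T.root := congrArg Subtype.val h
        exact absurd (h' ▸ hedge p) (T.root_no_parent _)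
      · have h' : p.2.1 = p'.2.1 := congrArg Subtype.val h
        have hv : p.1 = p'.1 := T.uniq_parent (hedge p) (h' ▸ hedge p')
        obtain ⟨v, u, hu⟩ := p
        obtain ⟨v', u', hu'⟩ := p'
        obtain rfl : v = v' := hv
        obtain rfl : u = u' := h'
        rfl
    · rintro ⟨u, hu⟩
      by_cases hp : ∃ p, T.edge p u
      · obtain ⟨p, hp⟩ := hp
        exact ⟨.inr ⟨p, u, Finset.mem_erase.2 ⟨fun h => hu ⟨p, h.symm⟩, mem_chiFin.2 hp⟩⟩, rfl⟩
      · exact ⟨.inl (), Subtype.ext (T.root_uniq u fun p h => hp ⟨p, h⟩).symm⟩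
  have hsub := tsum_subtype_eq_of_support_subset
    (f := fun v => (((T.chiFin hT v).card - 1 : ℕ) : ℝ≥0∞))
    (s := {v | 2 ≤ (T.chiFin hT v).card}) fun v hv => by
      have : (T.chiFin hT v).card - 1 ≠ 0 := fun h => hv <| by
        change (((T.chiFin hT v).card - 1 : ℕ) : ℝ≥0∞) = 0
        rw [h, Nat.cast_zero]
      change 2 ≤ _
      omega
  rw [← ENat.card_congr (Equiv.ofBijective g hg), ENat.card_sum, ENat.toENNReal_add,
    ← ENNReal.tsum_one (α := Σ _, _), ENNReal.tsum_sigma fun _ _ => 1]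
  congr 1
  · simp
  · refine Eq.trans (tsum_congr fun v => ?_) hsub.symm
    rw [ENNReal.tsum_one, ENat.card_eq_coe_fintype_card, Fintype.card_coe,
      Finset.card_erase_of_mem (mem_chiFin.2 (hc v))]
    simp

/-- The dimension of the wandering subspace of the Dirichlet shift with parameter `1`. -/
theorem toENNReal_rank_ker_adjoint (hL : T.Leafless) (hS : T.IsDirichletShift hT 1 S) :
    ((Module.rank ℂ (adjoint S).ker).toENat : ℝ≥0∞) =
      1 + ∑' v : {v : V // 2 ≤ (T.chiFin hT v).card},
        (((T.chiFin hT v.1).card - 1 : ℕ) : ℝ≥0∞) := by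
  choose c hc using hL
  rw [hS.toENat_rank_ker_adjoint (fun v => ⟨c v, hc v⟩) hc, T.enatCard_notMem_range hT hc]

end DirTree

end TreeShift

theorem stmt_14 {V₁ V₂ : Type} [Countable V₁] [Infinite V₁] [Countable V₂] [Infinite V₂]
    (T₁ : DirTree V₁) (hL₁ : T₁.Leafless) (hT₁ : T₁.LocFin)
    (T₂ : DirTree V₂) (hL₂ : T₂.Leafless) (hT₂ : T₂.LocFin)
    (S₁ : l2 V₁ →L[ℂ] l2 V₁) (hS₁ : T₁.IsDirichletShift hT₁ 1 S₁)
    (S₂ : l2 V₂ →L[ℂ] l2 V₂) (hS₂ : T₂.IsDirichletShift hT₂ 1 S₂) :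
    (∃ U : l2 V₁ ≃ₗᵢ[ℂ] l2 V₂, ∀ f : l2 V₁, U (S₁ f) = S₂ (U f)) ↔
      (∑' v : {v : V₁ // 2 ≤ (T₁.chiFin hT₁ v).card},
          (((T₁.chiFin hT₁ v.1).card - 1 : ℕ) : ℝ≥0∞)) =
        ∑' v : {v : V₂ // 2 ≤ (T₂.chiFin hT₂ v).card},
          (((T₂.chiFin hT₂ v.1).card - 1 : ℕ) : ℝ≥0∞) := by
  have hrank : (∃ U : l2 V₁ ≃ₗᵢ[ℂ] l2 V₂, ∀ f : l2 V₁, U (S₁ f) = S₂ (U f)) ↔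
      (Module.rank ℂ (adjoint S₁).ker).toENat = (Module.rank ℂ (adjoint S₂).ker).toENat := by
    constructor
    · rintro ⟨U, hU⟩
      refine congrArg _ (le_antisymm (rank_ker_adjoint_le_of_intertwining U hU)
        (rank_ker_adjoint_le_of_intertwining U.symm fun f => ?_))
      rw [U.symm_apply_eq, hU, U.apply_symm_apply]
    · intro h
      obtain ⟨s₁, b₁, -⟩ := exists_hilbertBasis ℂ (adjoint S₁).ker
      obtain ⟨s₂, b₂, -⟩ := exists_hilbertBasis ℂ (adjoint S₂).ker
      have : Countable s₁ := Orthonormal.countable_of_hilbertBasis (evecBasis V₁)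
        (b₁.orthonormal.comp_linearIsometry (adjoint S₁).ker.subtypeₗᵢ)
      have : Countable s₂ := Orthonormal.countable_of_hilbertBasis (evecBasis V₂)
        (b₂.orthonormal.comp_linearIsometry (adjoint S₂).ker.subtypeₗᵢ)
      rw [b₁.toENat_rank, b₂.toENat_rank] at h
      obtain ⟨e⟩ := exists_equiv_of_enatCard_eq h
      obtain ⟨B₁, hB₁⟩ := exists_hilbertBasis_shift (hS₁.adjoint_apply_apply hL₁)
        hS₁.eq_zero_of_forall_mem_range_pow b₁
      obtain ⟨B₂, hB₂⟩ := exists_hilbertBasis_shift (hS₂.adjoint_apply_apply hL₂)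
        hS₂.eq_zero_of_forall_mem_range_pow b₂
      exact exists_intertwining_of_shift_bases e B₁ hB₁ B₂ hB₂
  rw [hrank, ← ENat.toENNReal_inj, T₁.toENNReal_rank_ker_adjoint hL₁ hS₁,
    T₂.toENNReal_rank_ker_adjoint hL₂ hS₂, ENNReal.add_right_inj ENNReal.one_ne_top]

end
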